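/- arXiv:1601.04917 — 2 statements merged into one kernel-verified Lean document; each statement's English description precedes it below -/
import Mathlib

section
/- Let F(υ) = 3.9 υ(1−υ), γ₁(υ) = (1/2)(1 + √(1 − 4υ/3.9)), and define the bi-infinite sequence η = {η_k}_{k∈ℤ} by η_0 = 1/3.9, η_k = F^k(η_0) for k > 0, and η_k = γ₁^{−k}(η_0) for k < 0. Then η is an orbit of F, i.e., η_{k+1} = F(η_k) for all k ∈ ℤ, which is homoclinic to the fixed point η* = 2.9/3.9 of F: η_k → 2.9/3.9 as k → ∞ and η_k → 2.9/3.9 as k → −∞, while η ≠ the constant sequence η*. -/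
open Filter Topology

lemma g_step (x : ℝ) (hx : |x - 2.9 / 3.9| ≤ 0.187) :
    |(1 / 2) * (1 + Real.sqrt (1 - 4 * x / 3.9)) - 2.9 / 3.9| ≤ 0.8 * |x - 2.9 / 3.9| := by
  have h1 := (abs_le.1 hx).2
  have hs : (0.2 : ℝ) ≤ Real.sqrt (1 - 4 * x / 3.9) := by
    apply Real.le_sqrt_of_sq_le
    norm_num at h1 ⊢
    linarith
  have hsq : Real.sqrt (1 - 4 * x / 3.9) ^ 2 = 1 - 4 * x / 3.9 := by
    apply Real.sq_sqrt
    norm_num at h1 ⊢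
    linarith
  set s := Real.sqrt (1 - 4 * x / 3.9)
  have e : x - 2.9 / 3.9 = -((1 / 2) * (1 + s) - 2.9 / 3.9) * (1.95 * (s + 1.9 / 3.9)) := by
    have : x = (1 - s ^ 2) * 3.9 / 4 := by rw [hsq]; ring
    rw [this]; ring
  rw [e, abs_mul, abs_neg]
  have h2 : (1.25 : ℝ) ≤ |1.95 * (s + 1.9 / 3.9)| := by
    refine le_trans ?_ (le_abs_self _)
    norm_num at hs ⊢
    linarith
  have := mul_le_mul_of_nonneg_left h2 (abs_nonneg ((1 / 2) * (1 + s) - 2.9 / 3.9))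
  linarith

lemma g_one : |(1 / 2) * (1 + Real.sqrt (1 - 4 * (1 / 3.9) / 3.9)) - 2.9 / 3.9| ≤ (0.187 : ℝ) := by
  have h1 : Real.sqrt (1 - 4 * (1 / 3.9) / 3.9) ≤ (0.86 : ℝ) := by
    rw [Real.sqrt_le_left (by norm_num)]; norm_num
  have h2 : (0.85 : ℝ) ≤ Real.sqrt (1 - 4 * (1 / 3.9) / 3.9) := by
    apply Real.le_sqrt_of_sq_le; norm_num
  rw [abs_le]
  constructor
  · have : (-0.187 : ℝ) ≤ (1 / 2) * (1 + 0.85) - 2.9 / 3.9 := by norm_num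
    linarith
  · have : (1 / 2) * (1 + 0.86) - 2.9 / 3.9 ≤ (0.187 : ℝ) := by norm_num
    linarith

/-- The bi-infinite sequence `η` with `η₀ = 1/3.9`, forward iterates of
the logistic map `F(υ) = 3.9 υ(1−υ)` for `k > 0` and backward iterates of the inverse
branch `γ₁(υ) = (1/2)(1 + √(1 − 4υ/3.9))` for `k < 0`, is an orbit of `F` homoclinic to
the fixed point `η* = 2.9/3.9`. -/
theorem logistic_homoclinic_orbit
    (F γ₁ : ℝ → ℝ)
    (hF : ∀ υ : ℝ, F υ = 3.9 * υ * (1 - υ))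
    (hγ₁ : ∀ υ : ℝ, γ₁ υ = (1 / 2) * (1 + Real.sqrt (1 - 4 * υ / 3.9)))
    (η : ℤ → ℝ)
    (hη₀ : η 0 = 1 / 3.9)
    (hη_pos : ∀ k : ℤ, 0 < k → η k = F^[k.toNat] (1 / 3.9))
    (hη_neg : ∀ k : ℤ, k < 0 → η k = γ₁^[(-k).toNat] (1 / 3.9)) :
    (∀ k : ℤ, η (k + 1) = F (η k)) ∧
    F (2.9 / 3.9) = 2.9 / 3.9 ∧
    Tendsto η atTop (𝓝 (2.9 / 3.9)) ∧
    Tendsto η atBot (𝓝 (2.9 / 3.9)) ∧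
    η ≠ fun _ => 2.9 / 3.9 := by
  have hfix : F (2.9 / 3.9) = 2.9 / 3.9 := by rw [hF]; norm_num
  have hF1 : F (1 / 3.9) = 2.9 / 3.9 := by rw [hF]; norm_num
  have hpos : ∀ k : ℤ, 0 < k → η k = 2.9 / 3.9 := by
    intro k hk
    rw [hη_pos k hk]
    obtain ⟨n, hn⟩ : ∃ n, k.toNat = n + 1 := ⟨k.toNat - 1, by omega⟩
    rw [hn, Function.iterate_succ_apply, hF1]
    exact Function.iterate_fixed hfix n
  have hneg : ∀ n : ℕ, η (-(n : ℤ)) = γ₁^[n] (1 / 3.9) := by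
    intro n
    rcases Nat.eq_zero_or_pos n with rfl | h
    · simpa using hη₀
    · rw [hη_neg _ (by omega)]; simp
  have hbd : ∀ n : ℕ, |γ₁^[n + 1] (1 / 3.9) - 2.9 / 3.9| ≤ 0.187 * 0.8 ^ n := by
    intro n
    induction n with
    | zero =>
      simp only [zero_add, Function.iterate_one, pow_zero, mul_one]
      rw [hγ₁]; exact g_one
    | succ n ih =>
      rw [Function.iterate_succ_apply', hγ₁]
      have hp : (0.8 : ℝ) ^ n ≤ 1 := pow_le_one₀ (by norm_num) (by norm_num)
      have := g_step _ (ih.trans (by linarith))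
      rw [pow_succ]
      linarith
  have hle : ∀ n : ℕ, γ₁^[n] (1 / 3.9) ≤ 3.9 / 4 := by
    intro n
    rcases n with _ | n
    · norm_num
    · have hp : (0.8 : ℝ) ^ n ≤ 1 := pow_le_one₀ (by norm_num) (by norm_num)
      have h1 := (abs_le.1 (hbd n)).2
      have : (2.9 / 3.9 + 0.187 : ℝ) ≤ 3.9 / 4 := by norm_num
      linarith
  have hinv : ∀ x, x ≤ 3.9 / 4 → F (γ₁ x) = x := by
    intro x hx
    have hsq : Real.sqrt (1 - 4 * x / 3.9) ^ 2 = 1 - 4 * x / 3.9 := by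
      apply Real.sq_sqrt
      norm_num at hx ⊢
      linarith
    rw [hF, hγ₁]
    have : 3.9 * ((1 / 2) * (1 + Real.sqrt (1 - 4 * x / 3.9))) *
      (1 - (1 / 2) * (1 + Real.sqrt (1 - 4 * x / 3.9))) =
      3.9 / 4 * (1 - Real.sqrt (1 - 4 * x / 3.9) ^ 2) := by ring
    rw [this, hsq]; ring
  refine ⟨?_, hfix, ?_, ?_, ?_⟩
  · intro k
    rcases lt_trichotomy k 0 with h | h | h
    · obtain ⟨n, rfl⟩ : ∃ n : ℕ, k = -((n + 1 : ℕ) : ℤ) := ⟨(-k).toNat - 1, by omega⟩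
      have e : -((n + 1 : ℕ) : ℤ) + 1 = -(n : ℤ) := by push_cast; ring
      rw [e, hneg, hneg, Function.iterate_succ_apply', hinv _ (hle n)]
    · subst h
      rw [hη₀, hF1, hpos _ (by norm_num)]
    · rw [hpos _ h, hpos _ (by omega), hfix]
  · apply tendsto_const_nhds.congr'
    filter_upwards [eventually_gt_atTop 0] with k hk
    exact (hpos k hk).symm
  · have h1 : Tendsto (fun n : ℕ => γ₁^[n] (1 / 3.9)) atTop (𝓝 (2.9 / 3.9)) := by
      rw [← tendsto_add_atTop_iff_nat 1, tendsto_iff_norm_sub_tendsto_zero]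
      refine squeeze_zero (fun _ => norm_nonneg _) hbd ?_
      have := (tendsto_pow_atTop_nhds_zero_of_lt_one (r := (0.8 : ℝ))
        (by norm_num) (by norm_num)).const_mul 0.187
      simpa only [mul_zero] using this
    have h2 : Tendsto (fun k : ℤ => (-k).toNat) atBot atTop := by
      rw [tendsto_atTop]
      intro b
      filter_upwards [eventually_le_atBot (-(b : ℤ))] with k hk
      omega
    apply (h1.comp h2).congr'
    filter_upwards [eventually_lt_atBot 0] with k hk
    exact (hη_neg k hk).symm
  · intro h
    have := congrFun h 0
    rw [hη₀] at this
    norm_num at this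
end

section
/- Let F(υ) = 3.9 υ(1−υ), γ₂(υ) = (1/2)(1 − √(1 − 4υ/3.9)), and define the bi-infinite sequence η̄ = {η̄_k}_{k∈ℤ} by η̄_0 = 1/3.9, η̄_k = F^k(η̄_0) for k > 0, and η̄_k = γ₂^{−k}(η̄_0) for k < 0. Then η̄ is an orbit of F, i.e., η̄_{k+1} = F(η̄_k) for all k ∈ ℤ, which is heteroclinic to the fixed points η* = 2.9/3.9 and η** = 0 of F: η̄_k → 2.9/3.9 as k → ∞ and η̄_k → 0 as k → −∞, and η̄ differs from both constant sequences η* and η**. -/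
open Filter Topology

/-- The bi-infinite sequence `η̄` with `η̄₀ = 1/3.9`, forward iterates of
the logistic map `F(υ) = 3.9 υ(1−υ)` for `k > 0` and backward iterates of the inverse
branch `γ₂(υ) = (1/2)(1 − √(1 − 4υ/3.9))` for `k < 0`, is an orbit of `F` heteroclinic to
the fixed points `η* = 2.9/3.9` and `η** = 0`. -/
theorem logistic_heteroclinic_orbit
    (F γ₂ : ℝ → ℝ)
    (hF : ∀ υ : ℝ, F υ = 3.9 * υ * (1 - υ))
    (hγ₂ : ∀ υ : ℝ, γ₂ υ = (1 / 2) * (1 - Real.sqrt (1 - 4 * υ / 3.9)))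
    (ηb : ℤ → ℝ)
    (hηb₀ : ηb 0 = 1 / 3.9)
    (hηb_pos : ∀ k : ℤ, 0 < k → ηb k = F^[k.toNat] (1 / 3.9))
    (hηb_neg : ∀ k : ℤ, k < 0 → ηb k = γ₂^[(-k).toNat] (1 / 3.9)) :
    (∀ k : ℤ, ηb (k + 1) = F (ηb k)) ∧
    F (2.9 / 3.9) = 2.9 / 3.9 ∧ F 0 = 0 ∧
    Tendsto ηb atTop (𝓝 (2.9 / 3.9)) ∧
    Tendsto ηb atBot (𝓝 0) ∧
    ηb ≠ (fun _ => 2.9 / 3.9) ∧ ηb ≠ (fun _ => 0) := by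
  have hfix : F (2.9 / 3.9) = 2.9 / 3.9 := by rw [hF]; norm_num
  have hone : F (1 / 3.9) = 2.9 / 3.9 := by rw [hF]; norm_num
  have hg : ∀ x : ℝ, 0 ≤ x → x ≤ 1 / 3.9 →
      F (γ₂ x) = x ∧ 0 ≤ γ₂ x ∧ γ₂ x ≤ x * (1 / 1.95) := by
    intro x h0 h1
    norm_num at h1
    have hnn : (0 : ℝ) ≤ 1 - 4 * x / 3.9 := by norm_num; linarith
    have hs := Real.sq_sqrt hnn
    have hs0 := Real.sqrt_nonneg (1 - 4 * x / 3.9)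
    rw [hF, hγ₂]
    generalize Real.sqrt (1 - 4 * x / 3.9) = s at hs hs0
    norm_num at hs ⊢
    have hs1 : s ≤ 1 := by nlinarith
    refine ⟨by nlinarith, hs1, by nlinarith⟩
  have ha : ∀ n : ℕ, 0 ≤ γ₂^[n] (1 / 3.9) ∧
      γ₂^[n] (1 / 3.9) ≤ (1 / 3.9) * (1 / 1.95 : ℝ) ^ n := by
    intro n
    induction n with
    | zero => norm_num
    | succ n ih =>
      rw [Function.iterate_succ_apply', pow_succ, ← mul_assoc]
      have hp : (1 / 1.95 : ℝ) ^ n ≤ 1 := pow_le_one₀ (by norm_num) (by norm_num)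
      have hle : γ₂^[n] (1 / 3.9) ≤ 1 / 3.9 :=
        ih.2.trans (mul_le_of_le_one_right (by norm_num) hp)
      obtain ⟨_, h2, h3⟩ := hg _ ih.1 hle
      exact ⟨h2, h3.trans (mul_le_mul_of_nonneg_right ih.2 (by norm_num))⟩
  have hale : ∀ n : ℕ, γ₂^[n] (1 / 3.9) ≤ 1 / 3.9 := fun n =>
    (ha n).2.trans (mul_le_of_le_one_right (by norm_num)
      (pow_le_one₀ (by norm_num) (by norm_num)))
  have hFn : ∀ n : ℕ, F^[n + 1] (1 / 3.9) = 2.9 / 3.9 := by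
    intro n
    rw [Function.iterate_succ_apply, hone]
    exact Function.iterate_fixed hfix n
  have hpos : ∀ k : ℤ, 0 < k → ηb k = 2.9 / 3.9 := by
    intro k hk
    rw [hηb_pos k hk]
    obtain ⟨n, hn⟩ : ∃ n, k.toNat = n + 1 := ⟨k.toNat - 1, by omega⟩
    rw [hn, hFn]
  have hneg : ∀ k : ℤ, k ≤ 0 → ηb k = γ₂^[(-k).toNat] (1 / 3.9) := by
    intro k hk
    rcases hk.lt_or_eq with h | h
    · exact hηb_neg k h
    · subst h; simpa using hηb₀
  have hlim : Tendsto (fun n : ℕ => γ₂^[n] (1 / 3.9)) atTop (𝓝 0) := by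
    have h : Tendsto (fun n : ℕ => (1 / 3.9) * (1 / 1.95 : ℝ) ^ n) atTop (𝓝 0) := by
      simpa only [mul_zero] using
        (tendsto_pow_atTop_nhds_zero_of_lt_one (r := (1 / 1.95 : ℝ))
        (by norm_num) (by norm_num)).const_mul (1 / 3.9 : ℝ)
    exact squeeze_zero (fun n => (ha n).1) (fun n => (ha n).2) h
  refine ⟨?_, hfix, by rw [hF]; norm_num, ?_, ?_, ?_, ?_⟩
  · intro k
    rcases lt_trichotomy k 0 with h | h | h
    · rw [hneg k h.le, hneg (k + 1) (by omega)]
      have hn : (-k).toNat = (-(k + 1)).toNat + 1 := by omega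
      rw [hn, Function.iterate_succ_apply']
      exact (hg _ (ha _).1 (hale _)).1.symm
    · subst h
      rw [hηb₀, hone, hpos _ (by norm_num)]
    · rw [hpos k h, hpos (k + 1) (by omega), hfix]
  · refine tendsto_const_nhds.congr' ?_
    filter_upwards [eventually_gt_atTop (0 : ℤ)] with k hk
    exact (hpos k hk).symm
  · have ht : Tendsto (fun k : ℤ => (-k).toNat) atBot atTop := by
      refine tendsto_atTop.2 fun n => ?_
      filter_upwards [eventually_le_atBot (-(n : ℤ))] with k hk
      omega
    refine (hlim.comp ht).congr' ?_
    filter_upwards [eventually_le_atBot (0 : ℤ)] with k hk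
    exact (hneg k hk).symm
  · intro h
    have := congrFun h 0
    rw [hηb₀] at this
    norm_num at this
  · intro h
    have := congrFun h 0
    rw [hηb₀] at this
    norm_num at this
end
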